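/- Let X be a special (abstract) rank one group with unipotent subgroups A and B. For all 1 ≠ a ∈ A and 1 ≠ a' ∈ A, the element n(a)·n(a') lies in H := N_X(A) ∩ N_X(B), i.e., n(a)·n(a') normalizes both A and B. -/

import Mathlib

/-- The conjugate subgroup `S^g = g⁻¹ S g`. -/
def conjSub {X : Type*} [Group X] (S : Subgroup X) (g : X) : Subgroup X :=
  S.map (MulAut.conj g⁻¹).toMonoidHom

/-- `X` is an (abstract) rank one group with unipotent subgroups `A` and `B`:
`A ≠ B`, `X = ⟨A, B⟩`, for each `1 ≠ a ∈ A` there is `1 ≠ b ∈ B` with `A^b = B^a`,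
and vice versa. -/
structure IsRankOneGroup {X : Type*} [Group X] (A B : Subgroup X) : Prop where
  ne : A ≠ B
  gen : A ⊔ B = ⊤
  exB : ∀ a ∈ A, a ≠ 1 → ∃ b ∈ B, b ≠ 1 ∧ conjSub A b = conjSub B a
  exA : ∀ b ∈ B, b ≠ 1 → ∃ a ∈ A, a ≠ 1 ∧ conjSub B a = conjSub A b

/-- `bf` implements `a ↦ b(a)`, the unique `1 ≠ b ∈ B` with `A^b = B^a`, for `1 ≠ a ∈ A`. -/
def IsBFun {X : Type*} [Group X] (A B : Subgroup X) (bf : X → X) : Prop :=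
  ∀ a ∈ A, a ≠ 1 → bf a ∈ B ∧ bf a ≠ 1 ∧ conjSub A (bf a) = conjSub B a

/-- `af` implements `b ↦ a(b)`, the unique `1 ≠ a ∈ A` with `B^a = A^b`, for `1 ≠ b ∈ B`. -/
def IsAFun {X : Type*} [Group X] (A B : Subgroup X) (af : X → X) : Prop :=
  ∀ b ∈ B, b ≠ 1 → af b ∈ A ∧ af b ≠ 1 ∧ conjSub B (af b) = conjSub A b

/-- `X` is special: `b(a⁻¹) = b(a)⁻¹` for all `1 ≠ a ∈ A`. -/
def IsSpecialBFun {X : Type*} [Group X] (A B : Subgroup X) (bf : X → X) : Prop :=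
  IsBFun A B bf ∧ ∀ a ∈ A, a ≠ 1 → bf a⁻¹ = (bf a)⁻¹

/-- The special rank one group condition, phrased without a chosen `b`-function. -/
def IsSpecial {X : Type*} [Group X] (A B : Subgroup X) : Prop :=
  ∃ bf : X → X, IsSpecialBFun A B bf

theorem conjSub_mul {X : Type*} [Group X] (S : Subgroup X) (g k : X) :
    conjSub S (g * k) = conjSub (conjSub S g) k := by
  simp only [conjSub, Subgroup.map_map, mul_inv_rev, map_mul]
  rfl

theorem conjSub_one {X : Type*} [Group X] (S : Subgroup X) : conjSub S 1 = S := by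
  ext x
  simp [conjSub]

theorem conjSub_of_mem {X : Type*} [Group X] {S : Subgroup X} {g : X} (hg : g ∈ S) :
    conjSub S g = S := by
  ext x
  simp only [conjSub, Subgroup.mem_map, MulEquiv.coe_toMonoidHom, MulAut.conj_apply, inv_inv]
  constructor
  · rintro ⟨y, hy, rfl⟩
    exact S.mul_mem (S.mul_mem (S.inv_mem hg) hy) hg
  · intro hx
    exact ⟨g * x * g⁻¹, S.mul_mem (S.mul_mem hg hx) (S.inv_mem hg), by group⟩

/-- In a special rank one group, `n(a)` interchanges `A` and `B`. -/
theorem IsSpecialBFun.conjSub_swap {X : Type*} [Group X] {A B : Subgroup X} {bf : X → X}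
    (hbf : IsSpecialBFun A B bf) {a : X} (ha : a ∈ A) (ha1 : a ≠ 1) :
    conjSub A (a * (bf a)⁻¹ * a) = B ∧ conjSub B (a * (bf a)⁻¹ * a) = A := by
  constructor
  · rw [conjSub_mul, conjSub_mul, conjSub_of_mem ha, ← hbf.2 a ha ha1,
      (hbf.1 a⁻¹ (A.inv_mem ha) (inv_ne_one.mpr ha1)).2.2, ← conjSub_mul, inv_mul_cancel,
      conjSub_one]
  · rw [conjSub_mul, conjSub_mul, ← (hbf.1 a ha ha1).2.2, ← conjSub_mul A, mul_inv_cancel,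
      conjSub_one, conjSub_of_mem ha]

/-- In a special rank one group, `n(a)·n(a')` normalizes both `A` and `B`,
for all `1 ≠ a, a' ∈ A`. -/
theorem specialRankOne_nn_normalizes {X : Type*} [Group X] (A B : Subgroup X)
    (h : IsRankOneGroup A B) (bf : X → X) (hbf : IsSpecialBFun A B bf) :
    ∀ a ∈ A, a ≠ 1 → ∀ a' ∈ A, a' ≠ 1 →
      conjSub A ((a * (bf a)⁻¹ * a) * (a' * (bf a')⁻¹ * a')) = A ∧
      conjSub B ((a * (bf a)⁻¹ * a) * (a' * (bf a')⁻¹ * a')) = B := by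
  intro a ha ha1 a' ha' ha1'
  obtain ⟨hA, hB⟩ := hbf.conjSub_swap ha ha1
  obtain ⟨hA', hB'⟩ := hbf.conjSub_swap ha' ha1'
  exact ⟨by rw [conjSub_mul, hA, hB'], by rw [conjSub_mul, hB, hA']⟩
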